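/- arXiv:1004.1700 — 5 statements merged into one kernel-verified Lean document; each statement's English description precedes it below -/
import Mathlib

section
/- For every integer n ≥ 1, the map B_n defined on sl(2) by B_n(g d/dx)(f dx^{(1−n)/2}) = g′ f^{(n)} dx^{(1+n)/2} is a 1-cocycle of sl(2) with values in D_{(1−n)/2,(1+n)/2}: for all polynomials g, h of degree ≤ 2, B_n((g h′ − g′ h) d/dx) = L^{λ,μ}_{g d/dx}(B_n(h d/dx)) − L^{λ,μ}_{h d/dx}(B_n(g d/dx)) with λ = (1−n)/2, μ = (1+n)/2. -/
open Polynomial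

/-- The action `L^λ_{g d/dx}` of the vector field `g d/dx` on `λ`-densities `f dx^λ`:
`L^λ_{g d/dx}(f dx^λ) = (g f′ + λ g′ f) dx^λ`. -/
noncomputable def densityAct (lam : ℝ) (g f : Polynomial ℝ) : Polynomial ℝ :=
  g * derivative f + lam • (derivative g * f)

/-- The `(n+1)`-st derivative of the Lie derivative of a density along a vector field of
degree at most two. -/
theorem iterate_derivative_succ_densityAct (lam : ℝ) (g f : Polynomial ℝ)
    (hg : derivative (derivative (derivative g)) = 0) (n : ℕ) :
    derivative^[n + 1] (densityAct lam g f) =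
      g * derivative (derivative^[n + 1] f)
        + C (n + 1 + lam) * (derivative g * derivative^[n + 1] f)
        + C ((n + 1) * (n / 2 + lam)) * (derivative (derivative g) * derivative^[n] f) := by
  induction n with
  | zero =>
    simp [densityAct, smul_eq_C_mul]
    ring
  | succ n ih =>
    rw [Function.iterate_succ_apply', ih]
    have hcoeff : C (((n + 1 : ℕ) : ℝ) + 1 + lam) = C ((n : ℝ) + 1 + lam) + 1 := by
      rw [← C_1, ← C_add]
      push_cast
      ring_nf
    have hcoeff' : C ((((n + 1 : ℕ) : ℝ) + 1) * (((n + 1 : ℕ) : ℝ) / 2 + lam)) =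
        C (((n : ℝ) + 1) * (n / 2 + lam)) + C ((n : ℝ) + 1 + lam) := by
      rw [← C_add]
      push_cast
      ring_nf
    rw [hcoeff, hcoeff']
    simp only [derivative_add, derivative_mul, derivative_C, hg, Function.iterate_succ_apply']
    ring

/-- Bol's lemma: `f ↦ f^{(n)}` intertwines the `sl(2)`-actions on densities of weights
`(1 - n) / 2` and `(1 + n) / 2`. -/
theorem iterate_derivative_densityAct (n : ℕ) (hn : 1 ≤ n) (g f : Polynomial ℝ)
    (hg : g.degree ≤ 2) :
    derivative^[n] (densityAct ((1 - (n : ℝ)) / 2) g f) =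
      densityAct ((1 + (n : ℝ)) / 2) g (derivative^[n] f) := by
  obtain ⟨m, rfl⟩ := Nat.exists_eq_add_of_le' hn
  have hg' : derivative (derivative (derivative g)) = 0 :=
    iterate_derivative_eq_zero (x := 3) (Nat.lt_succ_of_le (natDegree_le_of_degree_le hg))
  have hweight : (m : ℝ) + 1 + (1 - ((m + 1 : ℕ) : ℝ)) / 2 = (1 + ((m + 1 : ℕ) : ℝ)) / 2 := by
    push_cast
    ring
  have hvanish : ((m : ℝ) + 1) * (m / 2 + (1 - ((m + 1 : ℕ) : ℝ)) / 2) = 0 := by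
    push_cast
    ring
  rw [iterate_derivative_succ_densityAct _ g f hg', hweight, hvanish, densityAct, smul_eq_C_mul]
  simp

/-- For every `n ≥ 1`, the map `B_n(g d/dx)(f dx^{(1−n)/2}) = g′ f^{(n)} dx^{(1+n)/2}`
is a 1-cocycle of `sl(2)` with values in `D_{(1−n)/2,(1+n)/2}`: for all polynomials `g, h` of
degree `≤ 2`, `B_n([X,Y]) = L^{λ,μ}_X(B_n(Y)) − L^{λ,μ}_Y(B_n(X))`, `λ = (1−n)/2`, `μ = (1+n)/2`. -/
theorem stmt1 (n : ℕ) (hn : 1 ≤ n) (g h : Polynomial ℝ)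
    (hg : g.degree ≤ 2) (hh : h.degree ≤ 2) (f : Polynomial ℝ) :
    derivative (g * derivative h - derivative g * h) * derivative^[n] f =
      (densityAct ((1 + (n : ℝ)) / 2) g (derivative h * derivative^[n] f)
          - derivative h * derivative^[n] (densityAct ((1 - (n : ℝ)) / 2) g f))
        - (densityAct ((1 + (n : ℝ)) / 2) h (derivative g * derivative^[n] f)
          - derivative g * derivative^[n] (densityAct ((1 - (n : ℝ)) / 2) h f)) := by
  rw [iterate_derivative_densityAct n hn g f hg, iterate_derivative_densityAct n hn h f hh]
  simp only [densityAct, smul_eq_C_mul, derivative_sub, derivative_mul]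
  ring
end

section
/- For every integer n ≥ 1, the map C_n defined on sl(2) by C_n(g d/dx)(f dx^{(1−n)/2}) = g″ f^{(n−1)} dx^{(1+n)/2} is a 1-cocycle of sl(2) with values in D_{(1−n)/2,(1+n)/2}: for all polynomials g, h of degree ≤ 2, C_n((g h′ − g′ h) d/dx) = L^{λ,μ}_{g d/dx}(C_n(h d/dx)) − L^{λ,μ}_{h d/dx}(C_n(g d/dx)) with λ = (1−n)/2, μ = (1+n)/2. -/
open Polynomial

theorem derivative_iterate_three_of_degree_le_two {g : Polynomial ℝ} (hg : g.degree ≤ 2) :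
    derivative (derivative (derivative g)) = 0 :=
  iterate_derivative_eq_zero (p := g) (x := 3)
    (lt_of_le_of_lt (natDegree_le_of_degree_le hg) (by norm_num))

/-- Leibniz rule for iterated derivatives of the action of a quadratic vector field. -/
theorem derivative_iterate_succ_densityAct (lam : ℝ) {g : Polynomial ℝ}
    (hg : derivative (derivative (derivative g)) = 0) (f : Polynomial ℝ) (m : ℕ) :
    derivative^[m + 1] (densityAct lam g f) =
      g * derivative^[m + 2] f + C (m + 1 + lam) * (derivative g * derivative^[m + 1] f)
        + C ((m + 1) * (m / 2 + lam)) * (derivative (derivative g) * derivative^[m] f) := by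
  induction m with
  | zero =>
    simp only [densityAct, smul_eq_C_mul, Function.iterate_succ_apply', Function.iterate_zero,
      id_eq, derivative_add, derivative_mul, derivative_C]
    simp
    ring
  | succ m ih =>
    rw [Function.iterate_succ_apply', ih]
    simp only [Function.iterate_succ_apply', derivative_add, derivative_mul, derivative_C, hg]
    have h₁ : C (((m + 1 : ℕ) : ℝ) + 1 + lam) = C ((m : ℝ) + 1 + lam) + 1 := by
      rw [← C_1, ← C_add]; congr 1; push_cast; ring
    have h₂ : C ((((m + 1 : ℕ) : ℝ) + 1) * (((m + 1 : ℕ) : ℝ) / 2 + lam)) =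
        C (((m : ℝ) + 1) * (m / 2 + lam)) + C ((m : ℝ) + 1 + lam) := by
      rw [← C_add]; congr 1; push_cast; ring
    rw [h₁, h₂]
    ring

/-- For every `n ≥ 1`, the map
`C_n(g d/dx)(f dx^{(1−n)/2}) = g″ f^{(n−1)} dx^{(1+n)/2}` is a 1-cocycle of `sl(2)` with values
in `D_{(1−n)/2,(1+n)/2}`: for all polynomials `g, h` of degree `≤ 2`,
`C_n([X,Y]) = L^{λ,μ}_X(C_n(Y)) − L^{λ,μ}_Y(C_n(X))`, `λ = (1−n)/2`, `μ = (1+n)/2`. -/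
theorem stmt2 (n : ℕ) (hn : 1 ≤ n) (g h : Polynomial ℝ)
    (hg : g.degree ≤ 2) (hh : h.degree ≤ 2) (f : Polynomial ℝ) :
    derivative (derivative (g * derivative h - derivative g * h)) * derivative^[n - 1] f =
      (densityAct ((1 + (n : ℝ)) / 2) g (derivative (derivative h) * derivative^[n - 1] f)
          - derivative (derivative h) * derivative^[n - 1] (densityAct ((1 - (n : ℝ)) / 2) g f))
        - (densityAct ((1 + (n : ℝ)) / 2) h (derivative (derivative g) * derivative^[n - 1] f)
          - derivative (derivative g) * derivative^[n - 1] (densityAct ((1 - (n : ℝ)) / 2) h f)) := by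
  have hg₃ := derivative_iterate_three_of_degree_le_two hg
  have hh₃ := derivative_iterate_three_of_degree_le_two hh
  obtain ⟨m, rfl⟩ := Nat.exists_eq_add_of_le' hn
  rw [Nat.add_sub_cancel]
  cases m with
  | zero =>
    simp only [densityAct, smul_eq_C_mul, Function.iterate_zero, id_eq, derivative_sub,
      derivative_mul, derivative_add, hg₃, hh₃]
    norm_num
    ring
  | succ m =>
    rw [derivative_iterate_succ_densityAct _ hg₃, derivative_iterate_succ_densityAct _ hh₃]
    have h₁ : C ((1 + ((m + 1 + 1 : ℕ) : ℝ)) / 2) =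
        C ((m : ℝ) + 1 + (1 - ((m + 1 + 1 : ℕ) : ℝ)) / 2) + 1 := by
      rw [← C_1, ← C_add]; congr 1; push_cast; ring
    simp only [densityAct, smul_eq_C_mul, Function.iterate_succ_apply', derivative_sub,
      derivative_mul, derivative_add, hg₃, hh₃, h₁]
    ring
end

section
/- Let n ≥ 1 be an integer and a, a′, b, c ∈ ℝ. Define on sl(2): A(g d/dx)(f) = g′ f (acting both on F_{(1−n)/2} and on F_{(1+n)/2}), B(g d/dx)(f) = g′ f^{(n)} and C(g d/dx)(f) = g″ f^{(n−1)} (both mapping F_{(1−n)/2} to F_{(1+n)/2}). Then there exists a scalar r ∈ ℝ, depending only on n, a, a′, b, c (and bilinear in (a,a′) and (b,c)), such that for all X = g d/dx and Y = h d/dx in sl(2), the antisymmetrized quadratic expression a′·A(X)∘(b·B(Y) + c·C(Y)) + (b·B(X) + c·C(X))∘a·A(Y) − a′·A(Y)∘(b·B(X) + c·C(X)) − (b·B(Y) + c·C(Y))∘a·A(X), as an operator F_{(1−n)/2} → F_{(1+n)/2}, equals r·Φ_n(X,Y), where Φ_n(g d/dx, h d/dx)(f) = (g′h″ − g″h′)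 f^{(n−1)}. In particular, the quadratic obstruction of the infinitesimal deformation of the sl(2)-module of symbols is a linear combination of the cocycles Φ_n. -/
open Polynomial

/-- Leibniz rule for the iterated derivative of a product whose left factor is affine. -/
theorem iterate_derivative_mul_of_derivative_derivative_eq_zero {R : Type*} [CommSemiring R]
    {p : R[X]} (hp : derivative (derivative p) = 0) (f : R[X]) (k : ℕ) :
    derivative^[k] (p * f)
      = p * derivative^[k] f + (k : R[X]) * (derivative p * derivative^[k - 1] f) := by
  induction k with
  | zero => simp
  | succ k ih =>
    rw [Function.iterate_succ_apply', ih]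
    cases k with
    | zero => simp [derivative_mul, add_comm]
    | succ k =>
      simp only [Nat.add_sub_cancel, Function.iterate_succ_apply', derivative_add, derivative_mul,
        derivative_natCast, hp]
      push_cast
      ring

theorem derivative_derivative_derivative_eq_zero_of_degree_le_two {R : Type*} [Semiring R]
    {g : R[X]} (hg : g.degree ≤ 2) : derivative (derivative (derivative g)) = 0 :=
  iterate_derivative_eq_zero (x := 3)
    (Nat.lt_succ_of_le (natDegree_le_iff_degree_le.mpr hg))

/-- Let `n ≥ 1` and `a, a′, b, c ∈ ℝ`.  With the cocycles
`A(g d/dx)(f) = g′ f`, `B(g d/dx)(f) = g′ f^{(n)}`, `C(g d/dx)(f) = g″ f^{(n−1)}`,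
there is a scalar `r ∈ ℝ` (depending only on `n, a, a′, b, c`) such that for all
`X = g d/dx`, `Y = h d/dx` in `sl(2)` (i.e. `g, h` of degree ≤ 2) the antisymmetrized
quadratic expression
`a′·A(X)∘(b·B(Y)+c·C(Y)) + (b·B(X)+c·C(X))∘a·A(Y)
  − a′·A(Y)∘(b·B(X)+c·C(X)) − (b·B(Y)+c·C(Y))∘a·A(X)`
equals `r·Φ_n(X,Y)`, where `Φ_n(g d/dx, h d/dx)(f) = (g′h″ − g″h′) f^{(n−1)}`. -/
theorem stmt5 (n : ℕ) (hn : 1 ≤ n) (a a' b c : ℝ) :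
    ∃ r : ℝ, ∀ g h : Polynomial ℝ, g.degree ≤ 2 → h.degree ≤ 2 → ∀ f : Polynomial ℝ,
      a' • (derivative g *
            (b • (derivative h * derivative^[n] f)
              + c • (derivative (derivative h) * derivative^[n - 1] f)))
        + (b • (derivative g * derivative^[n] (a • (derivative h * f)))
            + c • (derivative (derivative g) * derivative^[n - 1] (a • (derivative h * f))))
        - a' • (derivative h *
            (b • (derivative g * derivative^[n] f)
              + c • (derivative (derivative g) * derivative^[n - 1] f)))
        - (b • (derivative h * derivative^[n] (a • (derivative g * f)))
            + c • (derivative (derivative h) * derivative^[n - 1] (a • (derivative g * f))))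
      = r • ((derivative g * derivative (derivative h)
              - derivative (derivative g) * derivative h) * derivative^[n - 1] f) := by
  refine ⟨a' * c + n * (a * b) - a * c, fun g h hg hh f => ?_⟩
  have hg₃ := derivative_derivative_derivative_eq_zero_of_degree_le_two hg
  have hh₃ := derivative_derivative_derivative_eq_zero_of_degree_le_two hh
  simp only [iterate_derivative_smul,
    iterate_derivative_mul_of_derivative_derivative_eq_zero hg₃,
    iterate_derivative_mul_of_derivative_derivative_eq_zero hh₃]
  simp only [smul_eq_C_mul, map_add, map_sub, map_mul, map_natCast]
  ring
end

section
/- For every λ ∈ ℝ, the map Υ′_λ sending the contact vector field X_F to the multiplication operator Gα^λ ↦ (∂_x F)·G α^λ on 𝔉_λ is a 1-cocycle of the Lie superalgebra K(1) of all contact vector fields (and in particular of osp(1|2)) with values in 𝔇_{λ,λ}: for all homogeneous F, G ∈ ℝ[x,θ], Υ′_λ([X_F, X_G]) = 𝔏^{λ,λ}_{X_F}(Υ′_λ(X_G)) − (−1)^{p(F)p(G)} 𝔏^{λ,λ}_{X_G}(Υ′_λ(X_F)). -/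
open Polynomial

/-- Superfunctions `F = f₀(x) + θ f₁(x)` on `ℝ^{1|1}`, encoded as the pair `(f₀, f₁)`. -/
abbrev SF : Type := Polynomial ℝ × Polynomial ℝ

/-- The even derivative `∂_x`. -/
noncomputable def sdx (W : SF) : SF := (derivative W.1, derivative W.2)

/-- The odd vector field `η̄ = ∂_θ − θ∂_x`: `η̄(f₀ + θf₁) = f₁ − θf₀′`. -/
noncomputable def etaB (W : SF) : SF := (W.2, -derivative W.1)

/-- The (super)product of superfunctions:
`(f₀ + θf₁)(w₀ + θw₁) = f₀w₀ + θ(f₀w₁ + f₁w₀)`. -/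
noncomputable def sprod (F W : SF) : SF := (F.1 * W.1, F.1 * W.2 + F.2 * W.1)

/-- `(−1)^p` for a parity `p`. -/
def sgn (p : Bool) : ℝ := if p then -1 else 1

/-- `(−1)^{pq}` for parities `p, q`. -/
def sgn2 (p q : Bool) : ℝ := if p && q then -1 else 1

/-- `F` is homogeneous of parity `pF`: even means `F = f₀(x)`, odd means `F = θ f₁(x)`. -/
def Homog (F : SF) (pF : Bool) : Prop :=
  (pF = false → F.2 = 0) ∧ (pF = true → F.1 = 0)

/-- `X_F` lies in `osp(1|2) = Span(X_1, X_θ, X_x, X_{xθ}, X_{x²})`: `F` is homogeneous of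
parity `pF`, with `F ∈ span{1, x, x²}` in the even case and `F ∈ θ·span{1, x}` in the odd case. -/
def OspHomog (F : SF) (pF : Bool) : Prop :=
  (pF = false → F.2 = 0 ∧ F.1.degree ≤ 2) ∧ (pF = true → F.1 = 0 ∧ F.2.degree ≤ 1)

/-- The contact vector field `X_F = F∂_x − ½(−1)^{p(F)} η̄(F)η̄` of a homogeneous
superfunction `F` of parity `pF`. -/
noncomputable def Xf (F : SF) (pF : Bool) (W : SF) : SF :=
  sprod F (sdx W) - (sgn pF * (1 / 2 : ℝ)) • sprod (etaB F) (etaB W)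

/-- The action of `X_F` (of parity `pF`) on `λ`-densities:
`𝔏^λ_{X_F}(W α^λ) = (X_F(W) + λ (∂_x F) W)α^λ`. -/
noncomputable def lden (lam : ℝ) (F : SF) (pF : Bool) (W : SF) : SF :=
  Xf F pF W + lam • sprod (sdx F) W

/-- for every `λ ∈ ℝ`, the map `Υ′_λ : X_F ↦ (multiplication by ∂_x F)` is a
1-cocycle of `K(1)` (hence of `osp(1|2)`) with values in `𝔇_{λ,λ}`: whenever
`X_H = [X_F, X_G]` (so that `H = {F,G}`),
`Υ′_λ(X_H) = 𝔏^{λ,λ}_{X_F}(Υ′_λ(X_G)) − (−1)^{p(F)p(G)} 𝔏^{λ,λ}_{X_G}(Υ′_λ(X_F))`,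
where `𝔏^{λ,λ}_{X_F}(A) = 𝔏^λ_{X_F} ∘ A − (−1)^{p(A)p(F)} A ∘ 𝔏^λ_{X_F}` and
`Υ′_λ(X_G)` has parity `p(G)`. -/
theorem stmt10 (lam : ℝ) (F G H : SF) (pF pG : Bool)
    (hF : Homog F pF) (hG : Homog G pG) (hH : Homog H (xor pF pG))
    (hbr : ∀ W : SF, Xf F pF (Xf G pG W) - sgn2 pF pG • Xf G pG (Xf F pF W)
      = Xf H (xor pF pG) W) :
    ∀ W : SF,
      sprod (sdx H) W =
        (lden lam F pF (sprod (sdx G) W) - sgn2 pG pF • sprod (sdx G) (lden lam F pF W))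
          - sgn2 pF pG •
            (lden lam G pG (sprod (sdx F) W) - sgn2 pF pG • sprod (sdx F) (lden lam G pG W)) := by
  intro W
  obtain ⟨f₀, f₁⟩ := F
  obtain ⟨g₀, g₁⟩ := G
  obtain ⟨h₀, h₁⟩ := H
  obtain ⟨w₀, w₁⟩ := W
  have hX := hbr (X, 0)
  have two_inv : (2 : ℝ[X]) * C (2⁻¹) = 1 := by
    rw [← C_ofNat, ← C_mul]; norm_num
  cases pF <;> cases pG <;>
    simp [Homog] at hF hG hH <;> subst hF hG hH <;>
    simp [Xf, sprod, sdx, etaB, sgn, sgn2, smul_eq_C_mul, derivative_mul] at hX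
  all_goals
    have hD := congrArg derivative hX
    simp [derivative_mul] at hD
  all_goals simp only [lden, Xf, sprod, sdx, etaB, sgn, sgn2, Prod.ext_iff]
  all_goals simp [smul_eq_C_mul, derivative_mul]
  all_goals constructor <;> clear hbr hX <;> grind
end

section
/- For every integer k ≥ 1, the map Υ̃_k defined on osp(1|2) by Υ̃_k(X_G) = (−1)^{p(G)} ((k−1) η̄⁴(G) · η̄^{2k−3} + η̄³(G) · η̄^{2k−2}) (for k = 1 the term with factor (k−1) is understood to vanish), viewed as an odd linear map from 𝔉_{(1−k)/2} to 𝔉_{k/2}, is a 1-cocycle of osp(1|2) with values in 𝔇_{(1−k)/2, k/2} (with the Koszul sign conventions of Lie superalgebra Chevalley–Eilenberg cohomology): for all homogeneous X_F, X_G ∈ osp(1|2), Υ̃_k([X_F, X_G]) = 𝔏^{λ,μ}_{X_F}(Υ̃_k(X_G)) − (−1)^{p(F)p(G)} 𝔏^{λ,μ}_{X_G}(Υ̃_k(X_F)), with λ = (1−k)/2, μ = k/2. -/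
open Polynomial

/-- The 1-cocycle `Υ̃_k(X_G) = (−1)^{p(G)}((k−1) η̄⁴(G)·η̄^{2k−3} + η̄³(G)·η̄^{2k−2})`
(for `k = 1` the first term vanishes thanks to the factor `k−1`). -/
noncomputable def Upt (k : ℕ) (G : SF) (pG : Bool) (W : SF) : SF :=
  sgn pG • (((k : ℝ) - 1) • sprod (etaB^[4] G) (etaB^[2 * k - 3] W)
    + sprod (etaB^[3] G) (etaB^[2 * k - 2] W))

theorem iterate_derivative_derivative (n : ℕ) (p : ℝ[X]) :
    derivative^[n] (derivative p) = derivative (derivative^[n] p) :=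
  ((Function.Commute.refl _).iterate_left n).eq p

/-- Even iterates of `η̄`, from `η̄² = −∂_x`. -/
theorem etaB_iterate_two_mul (n : ℕ) (W : SF) :
    etaB^[2 * n] W =
      (C ((-1) ^ n) * derivative^[n] W.1, C ((-1) ^ n) * derivative^[n] W.2) := by
  induction n with
  | zero => simp
  | succ n ih =>
    rw [show 2 * (n + 1) = 2 * n + 1 + 1 by ring, Function.iterate_succ_apply',
      Function.iterate_succ_apply', ih]
    simp only [etaB, derivative_C_mul, Function.iterate_succ_apply', pow_succ]
    ext1 <;> simp

/-- Odd iterates of `η̄`. -/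
theorem etaB_iterate_two_mul_add_one (n : ℕ) (W : SF) :
    etaB^[2 * n + 1] W =
      (C ((-1) ^ n) * derivative^[n] W.2,
        -(C ((-1) ^ n) * derivative (derivative^[n] W.1))) := by
  rw [Function.iterate_succ_apply', etaB_iterate_two_mul]
  simp only [etaB, derivative_C_mul]

/-- Leibniz formula for a factor of degree at most one. -/
theorem iterate_derivative_mul_of_linear {h : ℝ[X]} (hh : derivative (derivative h) = 0)
    (n : ℕ) (p : ℝ[X]) :
    derivative^[n] (h * p) =
      h * derivative^[n] p + C (n : ℝ) * derivative h * derivative^[n - 1] p := by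
  induction n with
  | zero => simp
  | succ n ih =>
    rw [Function.iterate_succ_apply', ih]
    cases n <;>
    · simp [derivative_mul, hh, Function.iterate_succ_apply']
      try ring

/-- Leibniz formula for a factor of degree at most two and a derivative. -/
theorem iterate_derivative_mul_derivative_of_quadratic {f : ℝ[X]}
    (hf : derivative (derivative (derivative f)) = 0) (n : ℕ) (p : ℝ[X]) :
    derivative^[n] (f * derivative p) =
      f * derivative (derivative^[n] p) + C (n : ℝ) * derivative f * derivative^[n] p
        + C ((n : ℝ) * (n - 1) / 2) * derivative (derivative f) * derivative^[n - 1] p := by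
  induction n with
  | zero => simp
  | succ n ih =>
    rw [Function.iterate_succ_apply', ih]
    refine Polynomial.funext fun x => ?_
    cases n <;>
    · simp [derivative_mul, hf, Function.iterate_succ_apply']
      try ring

/-- `Υ̃_1(X_G) = (−1)^{p(G)} η̄³(G)`. -/
theorem Upt_one (G : SF) (pG : Bool) (W : SF) :
    Upt 1 G pG W = sgn pG • sprod (-derivative G.2, derivative (derivative G.1)) W := by
  simp [Upt, etaB]

/-- The components of `Υ̃_{n+2}(X_G)`. -/
theorem Upt_add_two (n : ℕ) (G : SF) (pG : Bool) (W : SF) :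
    Upt (n + 2) G pG W = (sgn pG * (-1) ^ n) •
      (((n : ℝ) + 1) • sprod (derivative (derivative G.1), derivative (derivative G.2))
          (derivative^[n] W.2, -derivative (derivative^[n] W.1))
        - sprod (-derivative G.2, derivative (derivative G.1))
          (derivative (derivative^[n] W.1), derivative (derivative^[n] W.2))) := by
  have h1 : 2 * (n + 2) - 3 = 2 * n + 1 := by omega
  have h2 : 2 * (n + 2) - 2 = 2 * (n + 1) := by omega
  rw [Upt, h1, h2, etaB_iterate_two_mul, etaB_iterate_two_mul_add_one]
  ext1 <;>
  · simp [etaB, sprod, smul_eq_C_mul, Function.iterate_succ_apply', pow_succ, map_ofNat]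
    ring

theorem OspHomog.of_even {F : SF} (hF : OspHomog F false) :
    F.2 = 0 ∧ derivative (derivative (derivative F.1)) = 0 :=
  ⟨(hF.1 rfl).1, iterate_derivative_eq_zero (x := 3)
    (Nat.lt_succ_of_le (natDegree_le_of_degree_le (hF.1 rfl).2))⟩

theorem OspHomog.of_odd {F : SF} (hF : OspHomog F true) :
    F.1 = 0 ∧ derivative (derivative F.2) = 0 :=
  ⟨(hF.2 rfl).1, iterate_derivative_eq_zero (x := 2)
    (Nat.lt_succ_of_le (natDegree_le_of_degree_le (hF.2 rfl).2))⟩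

/-- The bracket of two even contact fields is `X_{fg' − f'g}`. -/
theorem contact_bracket_even_even {f g h : ℝ[X]}
    (hbr : ∀ W : SF, Xf (f, 0) false (Xf (g, 0) false W)
      - sgn2 false false • Xf (g, 0) false (Xf (f, 0) false W) = Xf (h, 0) false W) :
    h = f * derivative g - derivative f * g := by
  refine Polynomial.funext fun x => ?_
  have := congrArg (fun W : SF => W.1.eval x) (hbr (X, 0))
  simp [Xf, sprod, sdx, etaB, sgn, sgn2] at this
  simp
  linarith

/-- The bracket of `X_f` and `X_{θg}` is `X_{θ(fg' − f'g/2)}`. -/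
theorem contact_bracket_even_odd {f g h : ℝ[X]}
    (hbr : ∀ W : SF, Xf (f, 0) false (Xf (0, g) true W)
      - sgn2 false true • Xf (0, g) true (Xf (f, 0) false W) = Xf (0, h) true W) :
    h = f * derivative g - (1 / 2 : ℝ) • (derivative f * g) := by
  refine Polynomial.funext fun x => ?_
  have := congrArg (fun W : SF => W.2.eval x) (hbr (X, 0))
  simp [Xf, sprod, sdx, etaB, sgn, sgn2] at this
  simp
  linarith

/-- The bracket of `X_{θf}` and `X_g` is `X_{θ(fg'/2 − f'g)}`. -/
theorem contact_bracket_odd_even {f g h : ℝ[X]}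
    (hbr : ∀ W : SF, Xf (0, f) true (Xf (g, 0) false W)
      - sgn2 true false • Xf (g, 0) false (Xf (0, f) true W) = Xf (0, h) true W) :
    h = (1 / 2 : ℝ) • (f * derivative g) - derivative f * g := by
  refine Polynomial.funext fun x => ?_
  have := congrArg (fun W : SF => W.2.eval x) (hbr (X, 0))
  simp [Xf, sprod, sdx, etaB, sgn, sgn2] at this
  simp
  linarith

/-- The bracket of `X_{θf}` and `X_{θg}` is `X_{fg/2}`. -/
theorem contact_bracket_odd_odd {f g h : ℝ[X]}
    (hbr : ∀ W : SF, Xf (0, f) true (Xf (0, g) true W)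
      - sgn2 true true • Xf (0, g) true (Xf (0, f) true W) = Xf (h, 0) false W) :
    h = (1 / 2 : ℝ) • (f * g) := by
  refine Polynomial.funext fun x => ?_
  have := congrArg (fun W : SF => W.1.eval x) (hbr (X, 0))
  simp [Xf, sprod, sdx, etaB, sgn, sgn2] at this
  simp
  linarith

/-- The cocycle identity for `Υ̃_k` at the pair `(X_F, X_G)` with bracket `X_H`, applied to the
density with coefficient `W`. -/
def UptCocycleAt (k : ℕ) (F G H : SF) (pF pG : Bool) (W : SF) : Prop :=
  Upt k H (xor pF pG) W =
    (lden ((k : ℝ) / 2) F pF (Upt k G pG W)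
        - sgn2 (!pG) pF • Upt k G pG (lden ((1 - (k : ℝ)) / 2) F pF W))
      - sgn2 pF pG •
        (lden ((k : ℝ) / 2) G pG (Upt k F pF W)
          - sgn2 (!pF) pG • Upt k F pF (lden ((1 - (k : ℝ)) / 2) G pG W))

theorem natCast_mul_eval_derivative_iterate_pred (n : ℕ) (p : ℝ[X]) (x : ℝ) :
    (n : ℝ) * (derivative (derivative^[n - 1] p)).eval x = n * (derivative^[n] p).eval x := by
  cases n with
  | zero => simp
  | succ n => rw [Nat.add_sub_cancel, Function.iterate_succ_apply']

theorem natCast_mul_eval_derivative_derivative_iterate_pred (n : ℕ) (p : ℝ[X]) (x : ℝ) :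
    (n : ℝ) * (derivative (derivative (derivative^[n - 1] p))).eval x =
      n * (derivative (derivative^[n] p)).eval x := by
  cases n with
  | zero => simp
  | succ n => rw [Nat.add_sub_cancel, Function.iterate_succ_apply']

theorem eq_one_or_exists_eq_add_two {k : ℕ} (hk : 1 ≤ k) : k = 1 ∨ ∃ n, k = n + 2 := by
  rcases Nat.exists_eq_add_of_le' hk with ⟨_ | n, rfl⟩
  exacts [.inl rfl, .inr ⟨n, rfl⟩]

/-- The cocycle identity at two even fields of `osp(1|2)`. -/
theorem uptCocycleAt_even_even {k : ℕ} (hk : 1 ≤ k) {f g : ℝ[X]}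
    (hf : derivative (derivative (derivative f)) = 0)
    (hg : derivative (derivative (derivative g)) = 0) (W : SF) :
    UptCocycleAt k (f, 0) (g, 0) (f * derivative g - derivative f * g, 0) false false W := by
  obtain ⟨u, v⟩ := W
  rcases eq_one_or_exists_eq_add_two hk with rfl | ⟨n, rfl⟩
  · simp only [UptCocycleAt, Upt_one]
    refine Prod.ext (Polynomial.funext fun x => ?_) (Polynomial.funext fun x => ?_) <;>
    · simp [lden, Xf, sprod, sdx, etaB, sgn, sgn2, derivative_mul, hf, hg]
      try ring
  · simp only [UptCocycleAt, Upt_add_two]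
    have hf₀ := iterate_derivative_mul_of_linear hf
    have hf₁ := iterate_derivative_mul_derivative_of_quadratic hf
    have hg₀ := iterate_derivative_mul_of_linear hg
    have hg₁ := iterate_derivative_mul_derivative_of_quadratic hg
    refine Prod.ext (Polynomial.funext fun x => ?_) (Polynomial.funext fun x => ?_) <;>
    · simp [lden, Xf, sprod, sdx, etaB, sgn, sgn2, derivative_mul, hf, hg,
        hf₀, hf₁, hg₀, hg₁]
      try ring

/-- The cocycle identity at an even and an odd field of `osp(1|2)`. -/
theorem uptCocycleAt_even_odd {k : ℕ} (hk : 1 ≤ k) {f g : ℝ[X]}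
    (hf : derivative (derivative (derivative f)) = 0)
    (hg : derivative (derivative g) = 0) (W : SF) :
    UptCocycleAt k (f, 0) (0, g) (0, f * derivative g - (1 / 2 : ℝ) • (derivative f * g))
      false true W := by
  obtain ⟨u, v⟩ := W
  rcases eq_one_or_exists_eq_add_two hk with rfl | ⟨n, rfl⟩
  · simp only [UptCocycleAt, Upt_one]
    refine Prod.ext (Polynomial.funext fun x => ?_) (Polynomial.funext fun x => ?_) <;>
    · simp [lden, Xf, sprod, sdx, etaB, sgn, sgn2, derivative_mul, hf, hg]
      try ring
  · simp only [UptCocycleAt, Upt_add_two]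
    have hf₀ := iterate_derivative_mul_of_linear hf
    have hf₁ := iterate_derivative_mul_derivative_of_quadratic hf
    have hg₀ := iterate_derivative_mul_of_linear hg
    have hg₂ := iterate_derivative_mul_of_linear (h := derivative g) (by simp [hg])
    refine Prod.ext (Polynomial.funext fun x => ?_) (Polynomial.funext fun x => ?_)
    · simp [lden, Xf, sprod, sdx, etaB, sgn, sgn2, derivative_mul, hf, hg,
        iterate_derivative_derivative, hf₀, hf₁, hg₀, hg₂]
      linear_combination ((n + 3) / 2 *
        (derivative (derivative f)).eval x * (derivative g).eval x * (-1) ^ n) *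
        natCast_mul_eval_derivative_iterate_pred n u x
    · simp [lden, Xf, sprod, sdx, etaB, sgn, sgn2, derivative_mul, hf, hg,
        iterate_derivative_derivative, hf₀, hf₁, hg₀, hg₂]
      linear_combination -((n + 1) / 2 *
        (derivative (derivative f)).eval x * (derivative g).eval x * (-1) ^ n) *
        natCast_mul_eval_derivative_iterate_pred n v x

/-- The cocycle identity at an odd and an even field of `osp(1|2)`. -/
theorem uptCocycleAt_odd_even {k : ℕ} (hk : 1 ≤ k) {f g : ℝ[X]}
    (hf : derivative (derivative f) = 0)
    (hg : derivative (derivative (derivative g)) = 0) (W : SF) :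
    UptCocycleAt k (0, f) (g, 0) (0, (1 / 2 : ℝ) • (f * derivative g) - derivative f * g)
      true false W := by
  obtain ⟨u, v⟩ := W
  rcases eq_one_or_exists_eq_add_two hk with rfl | ⟨n, rfl⟩
  · simp only [UptCocycleAt, Upt_one]
    refine Prod.ext (Polynomial.funext fun x => ?_) (Polynomial.funext fun x => ?_) <;>
    · simp [lden, Xf, sprod, sdx, etaB, sgn, sgn2, derivative_mul, hf, hg]
      try ring
  · simp only [UptCocycleAt, Upt_add_two]
    have hf₀ := iterate_derivative_mul_of_linear hf
    have hf₂ := iterate_derivative_mul_of_linear (h := derivative f) (by simp [hf])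
    have hg₀ := iterate_derivative_mul_of_linear hg
    have hg₁ := iterate_derivative_mul_derivative_of_quadratic hg
    refine Prod.ext (Polynomial.funext fun x => ?_) (Polynomial.funext fun x => ?_)
    · simp [lden, Xf, sprod, sdx, etaB, sgn, sgn2, derivative_mul, hf, hg,
        iterate_derivative_derivative, hf₀, hf₂, hg₀, hg₁]
      linear_combination -((n + 3) / 2 *
        (derivative f).eval x * (derivative (derivative g)).eval x * (-1) ^ n) *
        natCast_mul_eval_derivative_iterate_pred n u x
    · simp [lden, Xf, sprod, sdx, etaB, sgn, sgn2, derivative_mul, hf, hg,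
        iterate_derivative_derivative, hf₀, hf₂, hg₀, hg₁]
      linear_combination ((n + 1) / 2 *
        (derivative f).eval x * (derivative (derivative g)).eval x * (-1) ^ n) *
        natCast_mul_eval_derivative_iterate_pred n v x

/-- The cocycle identity at two odd fields of `osp(1|2)`. -/
theorem uptCocycleAt_odd_odd {k : ℕ} (hk : 1 ≤ k) {f g : ℝ[X]}
    (hf : derivative (derivative f) = 0)
    (hg : derivative (derivative g) = 0) (W : SF) :
    UptCocycleAt k (0, f) (0, g) ((1 / 2 : ℝ) • (f * g), 0) true true W := by
  obtain ⟨u, v⟩ := W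
  rcases eq_one_or_exists_eq_add_two hk with rfl | ⟨n, rfl⟩
  · simp only [UptCocycleAt, Upt_one]
    refine Prod.ext (Polynomial.funext fun x => ?_) (Polynomial.funext fun x => ?_) <;>
    · simp [lden, Xf, sprod, sdx, etaB, sgn, sgn2, derivative_mul, hf, hg]
      try ring
  · simp only [UptCocycleAt, Upt_add_two]
    have hf₀ := iterate_derivative_mul_of_linear hf
    have hf₂ := iterate_derivative_mul_of_linear (h := derivative f) (by simp [hf])
    have hg₀ := iterate_derivative_mul_of_linear hg
    have hg₂ := iterate_derivative_mul_of_linear (h := derivative g) (by simp [hg])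
    refine Prod.ext (Polynomial.funext fun x => ?_) (Polynomial.funext fun x => ?_)
    · simp [lden, Xf, sprod, sdx, etaB, sgn, sgn2, derivative_mul, hf, hg,
        iterate_derivative_derivative, hf₀, hf₂, hg₀, hg₂]
      linear_combination -((derivative f).eval x * (derivative g).eval x * (-1) ^ n) *
        natCast_mul_eval_derivative_iterate_pred n v x
    · simp [lden, Xf, sprod, sdx, etaB, sgn, sgn2, derivative_mul, hf, hg,
        iterate_derivative_derivative, hf₀, hf₂, hg₀, hg₂]
      linear_combination -((derivative f).eval x * (derivative g).eval x * (-1) ^ n) *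
        natCast_mul_eval_derivative_derivative_iterate_pred n u x

/-- for every `k ≥ 1`,
`Υ̃_k(X_G) = (−1)^{p(G)}((k−1) η̄⁴(G) η̄^{2k−3} + η̄³(G) η̄^{2k−2})`, viewed as an odd linear
map `𝔉_{(1−k)/2} → 𝔉_{k/2}` (so `Υ̃_k(X_G)` has parity `p(G)+1`), is a 1-cocycle of
`osp(1|2)` with values in `𝔇_{(1−k)/2,k/2}`: whenever `X_H = [X_F, X_G]` in `osp(1|2)`,
`Υ̃_k(X_H) = 𝔏^{λ,μ}_{X_F}(Υ̃_k(X_G)) − (−1)^{p(F)p(G)} 𝔏^{λ,μ}_{X_G}(Υ̃_k(X_F))`,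
with `λ = (1−k)/2`, `μ = k/2`. -/
theorem stmt12 (k : ℕ) (hk : 1 ≤ k) (F G H : SF) (pF pG : Bool)
    (hF : OspHomog F pF) (hG : OspHomog G pG) (hH : OspHomog H (xor pF pG))
    (hbr : ∀ W : SF, Xf F pF (Xf G pG W) - sgn2 pF pG • Xf G pG (Xf F pF W)
      = Xf H (xor pF pG) W) :
    ∀ W : SF,
      Upt k H (xor pF pG) W =
        (lden ((k : ℝ) / 2) F pF (Upt k G pG W)
            - sgn2 (!pG) pF • Upt k G pG (lden ((1 - (k : ℝ)) / 2) F pF W))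
          - sgn2 pF pG •
            (lden ((k : ℝ) / 2) G pG (Upt k F pF W)
              - sgn2 (!pF) pG • Upt k F pF (lden ((1 - (k : ℝ)) / 2) G pG W)) := by
  obtain ⟨F₀, F₁⟩ := F
  obtain ⟨G₀, G₁⟩ := G
  obtain ⟨H₀, H₁⟩ := H
  cases pF <;> cases pG
  · obtain ⟨rfl, hf⟩ := hF.of_even
    obtain ⟨rfl, hg⟩ := hG.of_even
    obtain ⟨rfl, -⟩ := hH.of_even
    obtain rfl := contact_bracket_even_even hbr
    exact uptCocycleAt_even_even hk hf hg
  · obtain ⟨rfl, hf⟩ := hF.of_even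
    obtain ⟨rfl, hg⟩ := hG.of_odd
    obtain ⟨rfl, -⟩ := hH.of_odd
    obtain rfl := contact_bracket_even_odd hbr
    exact uptCocycleAt_even_odd hk hf hg
  · obtain ⟨rfl, hf⟩ := hF.of_odd
    obtain ⟨rfl, hg⟩ := hG.of_even
    obtain ⟨rfl, -⟩ := hH.of_odd
    obtain rfl := contact_bracket_odd_even hbr
    exact uptCocycleAt_odd_even hk hf hg
  · obtain ⟨rfl, hf⟩ := hF.of_odd
    obtain ⟨rfl, hg⟩ := hG.of_odd
    obtain ⟨rfl, -⟩ := hH.of_even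
    obtain rfl := contact_bracket_odd_odd hbr
    exact uptCocycleAt_odd_odd hk hf hg
end
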